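/- Let τ be a positive integer, let C ≥ 0 and D ≥ 0 be reals with D·τ ≤ 1/2, and let (ω_t)_{t=0}^{T−1} and (a_t)_{t=0}^{T−1} be nonnegative reals satisfying, for every t ∈ {0, …, T−1}, ω_t ≤ C + D·Σ_{k=max(0, t−τ)}^{t−1} (ω_k + a_k). Then Σ_{t=0}^{T−1} ω_t ≤ 2·C·T + 2·D·τ·Σ_{t=0}^{T−1} a_t. -/

import Mathlib

open Finset

/-- Each index lies in at most `τ` of the windows `[t - τ, t)`, so the window sums of a nonnegative
sequence add up to at most `τ` times its sum. -/
theorem sum_range_sum_Ico_sub_le (τ T : ℕ) (f : ℕ → ℝ) (hf : ∀ t < T, 0 ≤ f t) :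
    ∑ t ∈ range T, ∑ k ∈ Ico (t - τ) t, f k ≤ τ * ∑ t ∈ range T, f t := by
  rw [sum_comm' (t' := range T) (s' := fun k => Ico (k + 1) (min (k + τ + 1) T))
    (by intro x y; simp only [mem_range, mem_Ico]; omega), mul_sum]
  refine sum_le_sum fun k hk => ?_
  rw [sum_const, nsmul_eq_mul, Nat.card_Ico]
  refine mul_le_mul_of_nonneg_right ?_ (hf k (mem_range.mp hk))
  exact_mod_cast (by omega : min (k + τ + 1) T - (k + 1) ≤ τ)

/-- A discrete Gronwall-type recursion with bounded delay: if `τ ≥ 1`,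
`C, D ≥ 0` with `D·τ ≤ 1/2`, and nonnegative reals `ω_t, a_t` (for `t < T`) satisfy
`ω_t ≤ C + D·∑_{k=max(0,t−τ)}^{t−1} (ω_k + a_k)`, then
`∑_{t<T} ω_t ≤ 2·C·T + 2·D·τ·∑_{t<T} a_t`. -/
theorem delayed_recursion_sum_bound
    (τ : ℕ) (hτ : 0 < τ) (C D : ℝ) (hC : 0 ≤ C) (hD : 0 ≤ D)
    (hDτ : D * (τ : ℝ) ≤ 1 / 2)
    (T : ℕ) (ω a : ℕ → ℝ)
    (hω : ∀ t < T, 0 ≤ ω t) (ha : ∀ t < T, 0 ≤ a t)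
    (hrec : ∀ t < T, ω t ≤ C + D * ∑ k ∈ Ico (t - τ) t, (ω k + a k)) :
    ∑ t ∈ range T, ω t ≤ 2 * C * T + 2 * D * (τ : ℝ) * ∑ t ∈ range T, a t := by
  have hwindow := sum_range_sum_Ico_sub_le τ T (fun k => ω k + a k)
    fun t ht => add_nonneg (hω t ht) (ha t ht)
  have hsum := sum_le_sum fun t ht => hrec t (mem_range.mp ht)
  rw [sum_add_distrib, sum_const, card_range, nsmul_eq_mul, ← mul_sum] at hsum
  rw [sum_add_distrib] at hwindow
  have hω_sum : 0 ≤ ∑ t ∈ range T, ω t := sum_nonneg fun t ht => hω t (mem_range.mp ht)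
  have hscaled := mul_le_mul_of_nonneg_left hwindow hD
  have habsorb := mul_le_mul_of_nonneg_right hDτ hω_sum
  linarith
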